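/- The eight states φ_1,…,φ_8 form an orthonormal family in ℂ^m ⊗ ℂ^n, and any nondisturbing measurement by the first party is trivial on them: if B is an m×m complex positive semidefinite (Hermitian) matrix such that ⟨φ_k, (B ⊗ I_n) φ_l⟩ = 0 for all 1 ≤ k, l ≤ 8 with k ≠ l, then ⟨φ_k, (B ⊗ I_n) φ_k⟩ = B_{00} for every 1 ≤ k ≤ 8. -/

import Mathlib

open scoped ComplexInnerProductSpace Kronecker ComplexOrder

/-- The `i`-th standard basis vector `|i⟩` of `ℂ^m` (zero if `i ≥ m`). -/
noncomputable def ket (m i : ℕ) : EuclideanSpace ℂ (Fin m) :=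
  (WithLp.equiv 2 (Fin m → ℂ)).symm fun a => if (a : ℕ) = i then 1 else 0

/-- The product state `v ⊗ w`, with entries `(v ⊗ w)_{(a,b)} = v_a * w_b`. -/
noncomputable def tp {m n : ℕ} (v : EuclideanSpace ℂ (Fin m)) (w : EuclideanSpace ℂ (Fin n)) :
    EuclideanSpace ℂ (Fin m × Fin n) :=
  (WithLp.equiv 2 (Fin m × Fin n → ℂ)).symm fun ab => v ab.1 * w ab.2

/-- The scalar `1/√2`. -/
noncomputable def invSqrt2 : ℂ := ((Real.sqrt 2)⁻¹ : ℝ)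

/-- A matrix on `ℂ^m ⊗ ℂ^n` acting as a linear map. -/
noncomputable def act {m n : ℕ} (M : Matrix (Fin m × Fin n) (Fin m × Fin n) ℂ)
    (x : EuclideanSpace ℂ (Fin m × Fin n)) : EuclideanSpace ℂ (Fin m × Fin n) :=
  Matrix.toEuclideanLin M x

/-- The eight product states `φ_1, …, φ_8` of Corollary 1. -/
noncomputable def phi (m n k : ℕ) : EuclideanSpace ℂ (Fin m × Fin n) :=
  if k = 1 then tp (ket m 1) (invSqrt2 • (ket n 0 + ket n 1))
  else if k = 2 then tp (ket m 1) (invSqrt2 • (ket n 0 - ket n 1))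
  else if k = 3 then tp (ket m 2) (invSqrt2 • (ket n 0 + ket n 2))
  else if k = 4 then tp (ket m 2) (invSqrt2 • (ket n 0 - ket n 2))
  else if k = 5 then tp (invSqrt2 • (ket m 0 + ket m 1)) (ket n 2)
  else if k = 6 then tp (invSqrt2 • (ket m 0 - ket m 1)) (ket n 2)
  else if k = 7 then tp (invSqrt2 • (ket m 0 + ket m 2)) (ket n 1)
  else tp (invSqrt2 • (ket m 0 - ket m 2)) (ket n 1)

theorem inner_tp_tp {m n : ℕ} (v v' : EuclideanSpace ℂ (Fin m)) (w w' : EuclideanSpace ℂ (Fin n)) :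
    ⟪tp v w, tp v' w'⟫ = ⟪v, v'⟫ * ⟪w, w'⟫ := by
  simp only [tp, PiLp.inner_apply, Fintype.sum_prod_type, Finset.sum_mul_sum, RCLike.inner_apply,
    WithLp.equiv_symm_apply, map_mul]
  refine Finset.sum_congr rfl fun a _ => Finset.sum_congr rfl fun b _ => ?_
  ring

theorem act_kronecker_one_tp {m n : ℕ} (B : Matrix (Fin m) (Fin m) ℂ)
    (v : EuclideanSpace ℂ (Fin m)) (w : EuclideanSpace ℂ (Fin n)) :
    act (B ⊗ₖ (1 : Matrix (Fin n) (Fin n) ℂ)) (tp v w) = tp (Matrix.toEuclideanLin B v) w := by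
  ext ⟨a, b⟩
  simp [act, tp, Matrix.toLpLin_apply, Matrix.mulVec, dotProduct, Fintype.sum_prod_type,
    Matrix.one_apply, Finset.sum_mul, mul_assoc]

theorem ket_eq_single {m i : ℕ} (hi : i < m) :
    ket m i = EuclideanSpace.single (⟨i, hi⟩ : Fin m) (1 : ℂ) := by
  ext a
  simp [ket, Fin.ext_iff]

theorem inner_ket_ket {m i j : ℕ} (hi : i < m) :
    ⟪ket m i, ket m j⟫ = if i = j then 1 else 0 := by
  rw [ket_eq_single hi, EuclideanSpace.inner_single_left]
  simp [ket]

theorem inner_ket_toEuclideanLin_ket {m i j : ℕ} (B : Matrix (Fin m) (Fin m) ℂ)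
    (hi : i < m) (hj : j < m) :
    ⟪ket m i, Matrix.toEuclideanLin B (ket m j)⟫ = B ⟨i, hi⟩ ⟨j, hj⟩ := by
  rw [ket_eq_single hi, ket_eq_single hj, EuclideanSpace.inner_single_left]
  simp [Matrix.toLpLin_apply]

theorem conj_invSqrt2 : (starRingEnd ℂ) invSqrt2 = invSqrt2 := Complex.conj_ofReal _

theorem invSqrt2_mul_self : invSqrt2 * invSqrt2 = 1 / 2 := by
  rw [invSqrt2, ← Complex.ofReal_mul, ← mul_inv, Real.mul_self_sqrt (by norm_num)]
  norm_num

theorem inner_phi_phi {m n : ℕ} (h3 : 3 ≤ m) (hmn : m ≤ n) {k l : ℕ} (hk : 1 ≤ k) (hk' : k ≤ 8)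
    (hl : 1 ≤ l) (hl' : l ≤ 8) : ⟪phi m n k, phi m n l⟫ = if k = l then 1 else 0 := by
  have hs := invSqrt2_mul_self
  have a0 : 0 < m := by omega
  have a1 : 1 < m := by omega
  have a2 : 2 < m := by omega
  have b0 : 0 < n := by omega
  have b1 : 1 < n := by omega
  have b2 : 2 < n := by omega
  interval_cases k <;> interval_cases l <;>
    simp [-inner_self_eq_norm_sq_to_K, phi, inner_tp_tp, inner_ket_ket, conj_invSqrt2,
      a0, a1, a2, b0, b1, b2] <;>
    linear_combination 2 * hs

theorem eight_states_orthonormal_and_trivial_measurement (m n : ℕ) (h3 : 3 ≤ m) (hmn : m ≤ n) :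
    (∀ k, 1 ≤ k → k ≤ 8 → ‖phi m n k‖ = 1) ∧
    (∀ k l, 1 ≤ k → k ≤ 8 → 1 ≤ l → l ≤ 8 → k ≠ l → ⟪phi m n k, phi m n l⟫ = 0) ∧
    (∀ B : Matrix (Fin m) (Fin m) ℂ, B.PosSemidef →
      (∀ k l, 1 ≤ k → k ≤ 8 → 1 ≤ l → l ≤ 8 → k ≠ l →
        ⟪phi m n k, act (B ⊗ₖ (1 : Matrix (Fin n) (Fin n) ℂ)) (phi m n l)⟫ = 0) →
      ∀ k, 1 ≤ k → k ≤ 8 →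
        ⟪phi m n k, act (B ⊗ₖ (1 : Matrix (Fin n) (Fin n) ℂ)) (phi m n k)⟫ =
          B (⟨0, by omega⟩ : Fin m) (⟨0, by omega⟩ : Fin m)) := by
  refine ⟨fun k hk hk' => ?_, fun k l hk hk' hl hl' hkl => ?_, fun B _ hB => ?_⟩
  · have h := inner_phi_phi h3 hmn hk hk' hk hk'
    rw [if_pos rfl, inner_self_eq_norm_sq_to_K] at h
    exact (pow_eq_one_iff_of_nonneg (norm_nonneg _) two_ne_zero).1
      (Complex.ofReal_injective (by simpa using h))
  · rw [inner_phi_phi h3 hmn hk hk' hl hl', if_neg hkl]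
  · have hs := invSqrt2_mul_self
    have hs0 : invSqrt2 ≠ 0 := by
      intro h
      norm_num [h] at hs
    have a0 : 0 < m := by omega
    have a1 : 1 < m := by omega
    have a2 : 2 < m := by omega
    have b0 : 0 < n := by omega
    have b1 : 1 < n := by omega
    have b2 : 2 < n := by omega
    have h13 := hB 1 3 (by norm_num) (by norm_num) (by norm_num) (by norm_num) (by norm_num)
    have h31 := hB 3 1 (by norm_num) (by norm_num) (by norm_num) (by norm_num) (by norm_num)
    have h17 := hB 1 7 (by norm_num) (by norm_num) (by norm_num) (by norm_num) (by norm_num)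
    have h71 := hB 7 1 (by norm_num) (by norm_num) (by norm_num) (by norm_num) (by norm_num)
    have h35 := hB 3 5 (by norm_num) (by norm_num) (by norm_num) (by norm_num) (by norm_num)
    have h53 := hB 5 3 (by norm_num) (by norm_num) (by norm_num) (by norm_num) (by norm_num)
    have h56 := hB 5 6 (by norm_num) (by norm_num) (by norm_num) (by norm_num) (by norm_num)
    have h78 := hB 7 8 (by norm_num) (by norm_num) (by norm_num) (by norm_num) (by norm_num)
    simp [-inner_self_eq_norm_sq_to_K, phi, act_kronecker_one_tp, inner_tp_tp, inner_ket_ket,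
      inner_ket_toEuclideanLin_ket, conj_invSqrt2, a0, a1, a2, b0, b1, b2, hs0]
      at h13 h31 h17 h71 h35 h53 h56 h78
    have h10 : B ⟨1, a1⟩ ⟨0, a0⟩ = 0 := by
      apply mul_left_cancel₀ hs0
      linear_combination h17 - invSqrt2 * h13
    have h01 : B ⟨0, a0⟩ ⟨1, a1⟩ = 0 := by
      apply mul_left_cancel₀ hs0
      linear_combination h71 - invSqrt2 * h31
    have h20 : B ⟨2, a2⟩ ⟨0, a0⟩ = 0 := by
      apply mul_left_cancel₀ hs0
      linear_combination h35 - invSqrt2 * h31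
    have h02 : B ⟨0, a0⟩ ⟨2, a2⟩ = 0 := by
      apply mul_left_cancel₀ hs0
      linear_combination h53 - invSqrt2 * h13
    have h11 : B ⟨1, a1⟩ ⟨1, a1⟩ = B ⟨0, a0⟩ ⟨0, a0⟩ := by
      apply mul_left_cancel₀ hs0
      linear_combination invSqrt2 * (h10 - h01) - h56
    have h22 : B ⟨2, a2⟩ ⟨2, a2⟩ = B ⟨0, a0⟩ ⟨0, a0⟩ := by
      apply mul_left_cancel₀ hs0
      linear_combination invSqrt2 * (h20 - h02) - h78
    intro k hk hk'
    interval_cases k <;>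
      simp [-inner_self_eq_norm_sq_to_K, phi, act_kronecker_one_tp, inner_tp_tp, inner_ket_ket,
        inner_ket_toEuclideanLin_ket, conj_invSqrt2, a0, a1, a2, b0, b1, b2,
        h01, h10, h02, h20, h11, h22] <;>
      linear_combination 2 * B ⟨0, a0⟩ ⟨0, a0⟩ * hs
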